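/- Let ξ = (r, m−r) be a two-part composition of m, and let C be a row-standard ξ-tableau of type α ⊨ m. Let B be the unique row-standard (m)-tableau of type ξ and A the unique row-standard (m)-tableau of type α. Then the composite φ_B φ_C : M^{(m)} → M^α (apply φ_B first, since maps act on the right) equals (∏_i [A^1_i choose C^1_i]_q) (∏_{i<j} q^{C^1_j C^2_i}) · φ_A. -/

import Mathlib

open scoped Classical

noncomputable section

namespace FayersSemistd

/-- The value at `q` of the Gaussian (quantum) binomial coefficient polynomial
`[a choose b]`, defined via the `q`-Pascal recurrence. -/
def qBinom {F : Type*} [Field F] (q : F) : ℕ → ℕ → F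
  | _, 0 => 1
  | 0, _+1 => 0
  | a+1, b+1 => qBinom q a b + q ^ (b+1) * qBinom q a (b+1)

/-- `∏_i [A_i + B_i choose A_i]_q`, where `A_i`, `B_i` are multiplicities in the
multisets `A` and `B`. -/
def qBinomProd {F : Type*} [Field F] (q : F) (A B : Multiset ℕ) : F :=
  ∏ i ∈ (A + B).toFinset, qBinom q ((A + B).count i) (A.count i)

/-- `∑_{i<j} A_j * B_i` : the number of pairs `(x,y)` with `x ∈ A`, `y ∈ B`, `y < x`,
counted with multiplicity. -/
def invPairs (A B : Multiset ℕ) : ℕ :=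
  ((A.product B).filter (fun p => p.2 < p.1)).card

/-- The Coxeter length of a permutation of `{0,…,n-1}`: its number of inversions. -/
def permLength {n : ℕ} (w : Equiv.Perm (Fin n)) : ℕ :=
  (Finset.univ.filter (fun p : Fin n × Fin n => p.1 < p.2 ∧ w p.2 < w p.1)).card

/-- `λ_0 + ⋯ + λ_{r-1}`. -/
def cumSum (lam : ℕ → ℕ) (r : ℕ) : ℕ := ∑ i ∈ Finset.range r, lam i

/-- The (0-indexed) row of the diagram of `λ` containing the (0-indexed) position `p`,
when positions are listed row by row. -/
def rowOf (lam : ℕ → ℕ) (p : ℕ) : ℕ := sInf {r | p < cumSum lam (r+1)}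

/-- `λ` is a composition of `n`: finitely many nonzero parts, summing to `n`. -/
def IsComposition (n : ℕ) (lam : ℕ → ℕ) : Prop :=
  ∃ N, (∀ r, N ≤ r → lam r = 0) ∧ cumSum lam N = n

/-- `μ` is a partition of `n`. -/
def IsPartition (n : ℕ) (mu : ℕ → ℕ) : Prop := IsComposition n mu ∧ Antitone mu

/-- The conjugate partition (0-indexed): `conjP μ i = #{r | μ r > i}`. -/
def conjP (mu : ℕ → ℕ) (i : ℕ) : ℕ := sInf {r | mu r ≤ i}

/-- The standard Young subgroup `W_λ` of `S_n` (as a set): the permutations preserving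
each consecutive block of sizes `λ_0, λ_1, …`. -/
def youngW {n : ℕ} (lam : ℕ → ℕ) : Set (Equiv.Perm (Fin n)) :=
  {w | ∀ p : Fin n, rowOf lam ((w p : Fin n) : ℕ) = rowOf lam (p : ℕ)}

/-- The adjacent transposition `(i, i+1)` (0-indexed) in `S_n`. -/
def adjT {n : ℕ} (i : ℕ) (h : i + 1 < n) : Equiv.Perm (Fin n) :=
  Equiv.swap ⟨i, Nat.lt_of_succ_lt h⟩ ⟨i+1, h⟩

/-- `T : S_n → H` is the standard basis of an Iwahori–Hecke algebra of `S_n` over `F`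
with parameter `q`.  Permutations act on the right, so the product `w·s` of the paper
is `s * w` in Mathlib's convention; the multiplication rule
`T_w T_s = T_{ws}` (length increasing) resp. `T_w T_s = q T_{ws} + (q-1) T_w`
(length decreasing) determines the algebra structure on the basis. -/
structure IsHeckeBasis {F : Type*} [Field F] {H : Type*} [Ring H] [Algebra F H] {n : ℕ}
    (q : F) (T : Equiv.Perm (Fin n) → H) : Prop where
  li : LinearIndependent F T
  total : Submodule.span F (Set.range T) = ⊤
  one : T 1 = 1
  mul_adj_asc : ∀ (w : Equiv.Perm (Fin n)) (i : ℕ) (h : i + 1 < n),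
    permLength w < permLength (adjT i h * w) →
    T w * T (adjT i h) = T (adjT i h * w)
  mul_adj_desc : ∀ (w : Equiv.Perm (Fin n)) (i : ℕ) (h : i + 1 < n),
    permLength (adjT i h * w) < permLength w →
    T w * T (adjT i h) = q • T (adjT i h * w) + (q - 1) • T w

variable {F : Type*} [Field F] {H : Type*} [Ring H] [Algebra F H] {n : ℕ}

/-- `x_λ = ∑_{w ∈ W_λ} T_w`. -/
def xElt (T : Equiv.Perm (Fin n) → H) (lam : ℕ → ℕ) : H :=
  ∑ w ∈ Finset.univ.filter (· ∈ youngW lam), T w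

/-- `y_λ = ∑_{w ∈ W_λ} (-q)^{-l(w)} T_w`. -/
def yElt (q : F) (T : Equiv.Perm (Fin n) → H) (lam : ℕ → ℕ) : H :=
  ∑ w ∈ Finset.univ.filter (· ∈ youngW lam), ((-q)⁻¹) ^ permLength w • T w

/-- The double coset `W_λ d W_μ` (paper convention: maps act on the right, so the
paper product `u·d·v` is `v * d * u` in Mathlib's convention). -/
def doubleCoset {n : ℕ} (lam mu : ℕ → ℕ) (d : Equiv.Perm (Fin n)) :
    Set (Equiv.Perm (Fin n)) :=
  {w | ∃ u ∈ youngW (n := n) lam, ∃ v ∈ youngW (n := n) mu, w = v * d * u}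

/-- `∑_{w ∈ W_λ 1_A W_μ} T_w`, the image `x_μ φ_A` of `x_μ` under the tableau
homomorphism `φ_A : M^μ → M^λ`, where `d = 1_A`. -/
def XPhi (T : Equiv.Perm (Fin n) → H) (lam mu : ℕ → ℕ) (d : Equiv.Perm (Fin n)) : H :=
  ∑ w ∈ Finset.univ.filter (· ∈ doubleCoset lam mu d), T w

/-- A row-standard tableau is recorded by the multisets of entries of its rows; it has
shape `μ` when row `r` has `μ_r` entries. -/
def RowsOfShape (mu : ℕ → ℕ) (A : ℕ → Multiset ℕ) : Prop := ∀ r, (A r).card = mu r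

/-- The tableau with rows `A 0, A 1, …` has type `λ` when the entry `v` occurs `λ_v`
times in total (entries and types are 0-indexed). -/
def HasType (A : ℕ → Multiset ℕ) (lam : ℕ → ℕ) : Prop :=
  ∀ v, (∑ᶠ r, (A r).count v) = lam v

/-- The entry in row `r`, column `c` (0-indexed) of the row-standard tableau with row
multisets `A`. -/
def entryAt (A : ℕ → Multiset ℕ) (r c : ℕ) : ℕ := ((A r).sort (· ≤ ·)).getD c 0

/-- `d = 1_A` for the row-standard `μ`-tableau `A` of type `λ`: the tableau `t^λ d`
(whose entry at position `p` is `d p`) is row-standard (first clause), and the entry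
`d p` lies in row `r` of `t^λ d` exactly when the position occupied by `d p` in `t^μ`
is occupied by `r` in `A` (second clause). -/
def Is1A {n : ℕ} (mu lam : ℕ → ℕ) (A : ℕ → Multiset ℕ) (d : Equiv.Perm (Fin n)) : Prop :=
  (∀ p p' : Fin n, rowOf lam (p : ℕ) = rowOf lam (p' : ℕ) → p < p' → d p < d p') ∧
  (∀ p : Fin n,
    entryAt A (rowOf mu ((d p : Fin n) : ℕ))
      (((d p : Fin n) : ℕ) - cumSum mu (rowOf mu ((d p : Fin n) : ℕ)))
      = rowOf lam (p : ℕ))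

/-- A row-standard tableau is semistandard if its columns are strictly increasing. -/
def Semistandard (mu : ℕ → ℕ) (A : ℕ → Multiset ℕ) : Prop :=
  ∀ r c, c < mu (r+1) → entryAt A r c < entryAt A (r+1) c

/-- The (0-indexed) column of the position `p` in the diagram of `μ`. -/
def colIdx (mu : ℕ → ℕ) (p : ℕ) : ℕ := p - cumSum mu (rowOf mu p)

/-- `w = w_μ`, i.e. `t^μ w = t_μ`: the image of position `p` is the number of positions
coming strictly before `p` in the column-reading order of the diagram of `μ`. -/
def IsWmu {n : ℕ} (mu : ℕ → ℕ) (w : Equiv.Perm (Fin n)) : Prop :=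
  ∀ p : Fin n, ((w p : Fin n) : ℕ) = (Finset.univ.filter (fun p' : Fin n =>
    colIdx mu (p' : ℕ) < colIdx mu (p : ℕ) ∨
      (colIdx mu (p' : ℕ) = colIdx mu (p : ℕ) ∧ rowOf mu (p' : ℕ) < rowOf mu (p : ℕ)))).card

def comp1 (a : ℕ) : ℕ → ℕ := fun r => if r = 0 then a else 0
def comp2 (a b : ℕ) : ℕ → ℕ := fun r => if r = 0 then a else if r = 1 then b else 0
def comp3 (a b c : ℕ) : ℕ → ℕ :=
  fun r => if r = 0 then a else if r = 1 then b else if r = 2 then c else 0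
def comp4 (a b c d : ℕ) : ℕ → ℕ :=
  fun r => if r = 0 then a else if r = 1 then b else if r = 2 then c else if r = 3 then d else 0
def rows1 (a : Multiset ℕ) : ℕ → Multiset ℕ := fun r => if r = 0 then a else 0
def rows2 (a b : Multiset ℕ) : ℕ → Multiset ℕ :=
  fun r => if r = 0 then a else if r = 1 then b else 0
def rows3 (a b c : Multiset ℕ) : ℕ → Multiset ℕ :=
  fun r => if r = 0 then a else if r = 1 then b else if r = 2 then c else 0
def rows4 (a b c d : Multiset ℕ) : ℕ → Multiset ℕ :=
  fun r => if r = 0 then a else if r = 1 then b else if r = 2 then c else if r = 3 then d else 0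

end FayersSemistd
namespace FayersSemistd

theorem adjT_inv {m i : ℕ} (h : i + 1 < m) : (adjT i h)⁻¹ = adjT i h := Equiv.swap_inv _ _

theorem adjT_mul_self {m i : ℕ} (h : i + 1 < m) : adjT i h * adjT i h = 1 := Equiv.swap_mul_self _ _

theorem adjT_apply_val {m i : ℕ} (h : i + 1 < m) (x : Fin m) :
    ((adjT i h x : Fin m) : ℕ) =
      if (x : ℕ) = i then i + 1 else if (x : ℕ) = i + 1 then i else x := by
  simp only [adjT, Equiv.swap_apply_def, Fin.ext_iff]
  split_ifs <;> rfl

/-- The value `i` precedes the value `i + 1` in the one-line word of `w`. -/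
def IsAscent {m : ℕ} (w : Equiv.Perm (Fin m)) (i : ℕ) (h : i + 1 < m) : Prop :=
  w⁻¹ ⟨i, Nat.lt_of_succ_lt h⟩ < w⁻¹ ⟨i + 1, h⟩

theorem not_isAscent_iff {m i : ℕ} (w : Equiv.Perm (Fin m)) (h : i + 1 < m) :
    ¬ IsAscent w i h ↔ IsAscent (adjT i h * w) i h := by
  have : w⁻¹ ⟨i, Nat.lt_of_succ_lt h⟩ ≠ w⁻¹ ⟨i + 1, h⟩ := by simp
  simp only [IsAscent, mul_inv_rev, adjT_inv, Equiv.Perm.mul_apply]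
  rw [adjT, Equiv.swap_apply_left, Equiv.swap_apply_right, not_lt]
  exact ⟨fun h => lt_of_le_of_ne h this.symm, le_of_lt⟩

theorem permLength_adjT_mul {m i : ℕ} (w : Equiv.Perm (Fin m)) (h : i + 1 < m)
    (hw : IsAscent w i h) : permLength (adjT i h * w) = permLength w + 1 := by
  unfold permLength
  rw [← Finset.card_insert_of_notMem
    (a := (w⁻¹ ⟨i, Nat.lt_of_succ_lt h⟩, w⁻¹ ⟨i + 1, h⟩))]
  · congr 1
    ext ⟨p, p'⟩
    have hw' : w⁻¹ ⟨i, Nat.lt_of_succ_lt h⟩ < w⁻¹ ⟨i + 1, h⟩ := hw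
    simp only [Finset.mem_filter, Finset.mem_univ, true_and, Finset.mem_insert, Prod.mk.injEq,
      Equiv.Perm.eq_inv_iff_eq, Equiv.Perm.mul_apply, Fin.lt_def, adjT_apply_val]
    by_cases h1 : ((w p : ℕ) = i ∧ (w p' : ℕ) = i + 1) ∨ ((w p : ℕ) = i + 1 ∧ (w p' : ℕ) = i)
    · rcases h1 with ⟨h1, h2⟩ | ⟨h1, h2⟩
      · have e1 : w p = ⟨i, Nat.lt_of_succ_lt h⟩ := Fin.ext h1
        have e2 : w p' = ⟨i + 1, h⟩ := Fin.ext h2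
        rw [← e1, ← e2] at hw'
        simp only [Equiv.Perm.coe_inv, Equiv.symm_apply_apply, Fin.lt_def] at hw'
        simp [e1, e2, hw']
      · have e1 : w p = ⟨i + 1, h⟩ := Fin.ext h1
        have e2 : w p' = ⟨i, Nat.lt_of_succ_lt h⟩ := Fin.ext h2
        rw [← e1, ← e2] at hw'
        simp only [Equiv.Perm.coe_inv, Equiv.symm_apply_apply, Fin.lt_def] at hw'
        simp [e1, e2]
        omega
    · simp only [Fin.ext_iff]
      split_ifs <;> omega
  · simp

theorem permLength_lt_iff {m i : ℕ} (w : Equiv.Perm (Fin m)) (h : i + 1 < m) :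
    permLength w < permLength (adjT i h * w) ↔ IsAscent w i h := by
  constructor
  · intro hl
    by_contra hw
    have := permLength_adjT_mul _ h ((not_isAscent_iff w h).1 hw)
    rw [← mul_assoc, adjT_mul_self, one_mul] at this
    omega
  · intro hw
    rw [permLength_adjT_mul w h hw]
    omega

theorem lt_of_adjacent_lt {m : ℕ} {f : Fin m → Fin m} {x y : Fin m} (hxy : x < y)
    (hf : ∀ i (h : i + 1 < m), (x : ℕ) ≤ i → i + 1 ≤ (y : ℕ) →
      f ⟨i, Nat.lt_of_succ_lt h⟩ < f ⟨i + 1, h⟩) : f x < f y := by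
  obtain ⟨y, hy⟩ := y
  induction y with
  | zero => exact absurd hxy (Nat.not_lt_zero _)
  | succ k ih =>
    have hk := hf k hy (Nat.lt_succ_iff.1 hxy) le_rfl
    rcases (Nat.lt_succ_iff.1 hxy).lt_or_eq with h | h
    · exact (ih (Nat.lt_of_succ_lt hy) h
        fun i hi h1 h2 => hf i hi h1 (Nat.le_succ_of_le h2)).trans hk
    · convert hk

theorem eq_one_of_strictMono {m : ℕ} {w : Equiv.Perm (Fin m)} (hw : StrictMono w) : w = 1 := by
  ext x
  have := Subsingleton.elim (StrictMono.orderIsoOfSurjective w hw w.surjective) (OrderIso.refl _)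
  exact congrArg (fun e : Fin m ≃o Fin m => ((e x : Fin m) : ℕ)) this

theorem perm_induction {m : ℕ} {P : Equiv.Perm (Fin m) → Prop} (one : P 1)
    (adj : ∀ w i h, IsAscent w i h → P w → P (adjT i h * w)) (w : Equiv.Perm (Fin m)) : P w := by
  induction hl : permLength w using Nat.strong_induction_on generalizing w with
  | _ l ih =>
    by_cases hw : ∀ i h, IsAscent w i h
    · have : w⁻¹ = 1 := eq_one_of_strictMono
        fun x y hxy => lt_of_adjacent_lt hxy fun i h _ _ => hw i h
      rw [inv_eq_one.1 this]
      exact one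
    · push Not at hw
      obtain ⟨i, h, hw⟩ := hw
      rw [not_isAscent_iff] at hw
      have hw' : adjT i h * (adjT i h * w) = w := by
        rw [← mul_assoc, adjT_mul_self, one_mul]
      have hl' := permLength_adjT_mul _ h hw
      rw [hw'] at hl'
      rw [← hw']
      exact adj _ i h hw (ih _ (by omega) _ rfl)

namespace IsHeckeBasis

variable {F : Type*} [Field F] {H : Type*} [Ring H] [Algebra F H] {m : ℕ} {q : F}
  {T : Equiv.Perm (Fin m) → H}

theorem mul_adjT (hT : IsHeckeBasis q T) {w : Equiv.Perm (Fin m)} {i : ℕ} {h : i + 1 < m}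
    (hw : IsAscent w i h) : T w * T (adjT i h) = T (adjT i h * w) :=
  hT.mul_adj_asc w i h ((permLength_lt_iff w h).2 hw)

/-- Multiplication of basis elements when no inversion of `v` is undone by `g`. -/
theorem mul_of_inversions (hT : IsHeckeBasis q T) (g v : Equiv.Perm (Fin m))
    (hgv : ∀ x y, x < y → v y < v x → g⁻¹ x < g⁻¹ y) : T g * T v = T (v * g) := by
  induction v using perm_induction with
  | one => rw [hT.one, mul_one, one_mul]
  | adj v i h hv ih =>
    have hi : adjT i h ⟨i, Nat.lt_of_succ_lt h⟩ = ⟨i + 1, h⟩ := Equiv.swap_apply_left _ _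
    have hi' : adjT i h ⟨i + 1, h⟩ = ⟨i, Nat.lt_of_succ_lt h⟩ := Equiv.swap_apply_right _ _
    rw [← hT.mul_adjT hv, ← mul_assoc, ih, hT.mul_adjT, mul_assoc]
    · have := hgv _ _ hv
      simp only [Equiv.Perm.mul_apply, Equiv.Perm.coe_inv, Equiv.apply_symm_apply, hi, hi'] at this
      exact this (Nat.lt_succ_self i)
    · intro x y hxy hvxy
      refine hgv x y hxy ?_
      simp only [Equiv.Perm.mul_apply, Fin.lt_def, adjT_apply_val] at hvxy ⊢
      by_cases hx : (v x : ℕ) = i + 1 ∧ (v y : ℕ) = i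
      · have e1 : v x = ⟨i + 1, h⟩ := Fin.ext hx.1
        have e2 : v y = ⟨i, Nat.lt_of_succ_lt h⟩ := Fin.ext hx.2
        have hv' : v⁻¹ ⟨i, Nat.lt_of_succ_lt h⟩ < v⁻¹ ⟨i + 1, h⟩ := hv
        rw [← e1, ← e2] at hv'
        simp only [Equiv.Perm.coe_inv, Equiv.symm_apply_apply] at hv'
        exact absurd hxy hv'.not_gt
      · split_ifs <;> omega

theorem adjT_mul (hT : IsHeckeBasis q T) {v : Equiv.Perm (Fin m)} {i : ℕ} {h : i + 1 < m}
    (hv : v ⟨i, Nat.lt_of_succ_lt h⟩ < v ⟨i + 1, h⟩) :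
    T (adjT i h) * T v = T (v * adjT i h) := by
  refine hT.mul_of_inversions _ _ fun x y hxy hvxy => ?_
  simp only [adjT_inv, Fin.lt_def, adjT_apply_val] at hxy ⊢
  by_cases hx : (x : ℕ) = i ∧ (y : ℕ) = i + 1
  · have e1 : x = ⟨i, Nat.lt_of_succ_lt h⟩ := Fin.ext hx.1
    have e2 : y = ⟨i + 1, h⟩ := Fin.ext hx.2
    rw [e1, e2] at hvxy
    exact absurd hv hvxy.not_gt
  · split_ifs <;> omega

theorem adjT_mul_adjT (hT : IsHeckeBasis q T) {i : ℕ} (h : i + 1 < m) :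
    T (adjT i h) * T (adjT i h) = q • 1 + (q - 1) • T (adjT i h) := by
  have h1 : IsAscent (1 : Equiv.Perm (Fin m)) i h := by simp [IsAscent, Fin.lt_def]
  have := permLength_adjT_mul _ h h1
  rw [mul_one] at this
  rw [hT.mul_adj_desc, adjT_mul_self, hT.one]
  rw [adjT_mul_self]
  omega

theorem adjT_mul_sum (hT : IsHeckeBasis q T) {i : ℕ} (h : i + 1 < m) :
    T (adjT i h) * ∑ w, T w = q • ∑ w, T w := by
  set s := adjT i h with hs
  let A : Equiv.Perm (Fin m) → Prop := fun v => v ⟨i, Nat.lt_of_succ_lt h⟩ < v ⟨i + 1, h⟩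
  have hA : ∀ v, A (v * s) ↔ ¬ A v := by
    intro v
    have : v ⟨i, Nat.lt_of_succ_lt h⟩ ≠ v ⟨i + 1, h⟩ := by simp
    simp only [A, Equiv.Perm.mul_apply, hs]
    rw [adjT, Equiv.swap_apply_left, Equiv.swap_apply_right, not_lt]
    exact ⟨le_of_lt, fun h => lt_of_le_of_ne h this.symm⟩
  have hss : ∀ v, v * s * s = v := fun v => by rw [mul_assoc, adjT_mul_self, mul_one]
  have key : ∀ v, T s * T v =
      (if A (v * s) then 0 else T (v * s)) +
      ((if A v then 0 else (q - 1) • T v) + (if A (v * s) then q • T (v * s) else 0)) := by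
    intro v
    by_cases hv : A v
    · have : ¬ A (v * s) := fun h' => (hA v).1 h' hv
      simp [hv, this, s, hT.adjT_mul hv]
    · have hv' := (hA v).2 hv
      have e := hT.adjT_mul hv'
      rw [← hs, hss] at e
      rw [if_pos hv', if_neg hv, if_pos hv', ← e, ← mul_assoc, hT.adjT_mul_adjT, add_mul,
        smul_mul_assoc, smul_mul_assoc, one_mul, e]
      abel
  rw [Finset.mul_sum, Finset.sum_congr rfl fun v _ => key v, Finset.sum_add_distrib,
    Finset.sum_add_distrib,
    Fintype.sum_equiv (Equiv.mulRight s) (fun v => if A (v * s) then 0 else T (v * s))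
      (fun v => if A v then 0 else T v) (fun _ => rfl),
    Fintype.sum_equiv (Equiv.mulRight s) (fun v => if A (v * s) then q • T (v * s) else 0)
      (fun v => if A v then q • T v else 0) (fun _ => rfl),
    ← Finset.sum_add_distrib, ← Finset.sum_add_distrib, Finset.smul_sum]
  refine Finset.sum_congr rfl fun v _ => ?_
  split_ifs
  · simp
  · rw [sub_smul, one_smul]; abel

theorem mul_sum (hT : IsHeckeBasis q T) (g : Equiv.Perm (Fin m)) :
    T g * ∑ w, T w = q ^ permLength g • ∑ w, T w := by
  induction g using perm_induction with
  | one =>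
    have : permLength (1 : Equiv.Perm (Fin m)) = 0 := by
      rw [permLength, Finset.card_eq_zero, Finset.filter_eq_empty_iff]
      exact fun p _ hp => lt_asymm hp.1 hp.2
    rw [this, hT.one, one_mul, pow_zero, one_smul]
  | adj g i h hg ih =>
    rw [← hT.mul_adjT hg, mul_assoc, hT.adjT_mul_sum, mul_smul_comm, ih, smul_smul,
      permLength_adjT_mul g h hg, pow_succ']

end IsHeckeBasis

section Words

/-- The multiset of labels `ρ p` over the positions `p` at which the word `b` is true. -/
def wordContent {m : ℕ} (ρ : Fin m → ℕ) (b : Fin m → Bool) : Multiset ℕ :=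
  ∑ p, if b p then {ρ p} else 0

/-- The number of pairs of positions at which the word `b` reads false, then true. -/
def wordInv {m : ℕ} (b : Fin m → Bool) : ℕ :=
  ∑ p, ∑ p', if p < p' ∧ b p = false ∧ b p' = true then 1 else 0

theorem wordContent_cons {m : ℕ} (ρ : Fin (m + 1) → ℕ) (x : Bool) (b : Fin m → Bool) :
    wordContent ρ (Fin.cons x b) =
      (if x then {ρ 0} else 0) + wordContent (fun p => ρ p.succ) b := by
  simp [wordContent, Fin.sum_univ_succ]

theorem card_wordContent {m : ℕ} (ρ : Fin m → ℕ) (b : Fin m → Bool) :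
    (wordContent ρ b).card = ∑ p, if b p = true then 1 else 0 := by
  rw [wordContent, Multiset.card_sum]
  refine Finset.sum_congr rfl fun p _ => ?_
  split_ifs <;> simp

theorem wordInv_cons {m : ℕ} (ρ : Fin m → ℕ) (x : Bool) (b : Fin m → Bool) :
    wordInv (Fin.cons x b : Fin (m + 1) → Bool) =
      (if x then 0 else (wordContent ρ b).card) + wordInv b := by
  rw [card_wordContent]
  simp only [wordInv, Fin.sum_univ_succ, Fin.cons_zero, Fin.cons_succ]
  cases x <;> simp [-Finset.sum_boole]

theorem count_wordContent {m : ℕ} (ρ : Fin m → ℕ) (b : Fin m → Bool) (i : ℕ) :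
    (wordContent ρ b).count i = (Finset.univ.filter fun p => ρ p = i ∧ b p = true).card := by
  rw [wordContent, Multiset.count_sum', Finset.card_filter]
  refine Finset.sum_congr rfl fun p _ => ?_
  by_cases hp : i = ρ p
  · by_cases hb : b p = true <;> simp [hb, hp]
  · by_cases hb : b p = true <;> simp [hb, hp, Ne.symm hp]

theorem exists_perm_comp_eq {ι κ : Type*} [Fintype ι] (f g : ι → κ)
    (h : ∀ k, (Finset.univ.filter fun x => f x = k).card
      = (Finset.univ.filter fun x => g x = k).card) :
    ∃ σ : Equiv.Perm ι, ∀ x, g (σ x) = f x := by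
  have e : ∀ k, Nonempty ({x // f x = k} ≃ {x // g x = k}) := fun k =>
    Fintype.card_eq.1 (by rw [Fintype.card_subtype, Fintype.card_subtype, h])
  refine ⟨(Equiv.sigmaFiberEquiv f).symm.trans
    ((Equiv.sigmaCongrRight fun k => (e k).some).trans (Equiv.sigmaFiberEquiv g)), fun x => ?_⟩
  exact ((e (f x)).some ⟨x, rfl⟩).2

theorem exists_perm_of_wordContent_eq {m : ℕ} (ρ : Fin m → ℕ) (b b' : Fin m → Bool)
    (h : wordContent ρ b = wordContent ρ b') :
    ∃ σ : Equiv.Perm (Fin m), ∀ p, ρ (σ p) = ρ p ∧ b' (σ p) = b p := by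
  have key : ∀ (c : Fin m → Bool) (i : ℕ),
      (Finset.univ.filter fun p => ρ p = i ∧ c p = false).card + (wordContent ρ c).count i
        = (Finset.univ.filter fun p => ρ p = i).card := by
    intro c i
    rw [count_wordContent, ← Finset.card_union_of_disjoint]
    · congr 1
      ext p
      cases hc : c p <;> simp [hc]
    · rw [Finset.disjoint_filter]
      simp +contextual
  obtain ⟨σ, hσ⟩ := exists_perm_comp_eq (fun p => (ρ p, b p)) (fun p => (ρ p, b' p)) (by
    rintro ⟨i, _ | _⟩
    · have h1 := key b i
      have h2 := key b' i
      rw [h] at h1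
      simp only [Prod.mk.injEq]
      omega
    · have := congrArg (Multiset.count i) h
      rw [count_wordContent, count_wordContent] at this
      simpa only [Prod.mk.injEq] using this)
  exact ⟨σ, fun p => Prod.mk.inj (hσ p)⟩

end Words

section GeneratingFunction

variable {F : Type*} [Field F] (q : F)

theorem qBinom_zero_right (a : ℕ) : qBinom q a 0 = 1 := by cases a <;> rfl

theorem qBinom_of_lt {a b : ℕ} (h : a < b) : qBinom q a b = 0 := by
  induction a generalizing b with
  | zero => obtain ⟨b, rfl⟩ := Nat.exists_eq_succ_of_ne_zero h.ne'; rfl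
  | succ a ih =>
    obtain ⟨b, rfl⟩ := Nat.exists_eq_succ_of_ne_zero (Nat.ne_zero_of_lt h)
    rw [qBinom, ih (by omega), ih (by omega), mul_zero, add_zero]

theorem qBinom_self (a : ℕ) : qBinom q a a = 1 := by
  induction a with
  | zero => rfl
  | succ a ih => rw [qBinom, ih, qBinom_of_lt q a.lt_succ_self, mul_zero, add_zero]

theorem qBinomProd_eq_mul_filter (a : ℕ) (A B : Multiset ℕ) :
    qBinomProd q A B = qBinom q (A.count a + B.count a) (A.count a) *
      qBinomProd q (A.filter (· ≠ a)) (B.filter (· ≠ a)) := by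
  unfold qBinomProd
  have h1 : (A.filter (· ≠ a) + B.filter (· ≠ a)).toFinset = (A + B).toFinset.erase a := by
    ext i
    simp only [Multiset.mem_toFinset, Multiset.mem_add, Multiset.mem_filter, Finset.mem_erase]
    tauto
  have h2 : ∏ i ∈ (A + B).toFinset.erase a,
        qBinom q ((A.filter (· ≠ a) + B.filter (· ≠ a)).count i) ((A.filter (· ≠ a)).count i)
      = ∏ i ∈ (A + B).toFinset.erase a, qBinom q ((A + B).count i) (A.count i) := by
    refine Finset.prod_congr rfl fun i hi => ?_
    have hia : i ≠ a := Finset.ne_of_mem_erase hi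
    rw [Multiset.count_add, Multiset.count_add, Multiset.count_filter_of_pos (p := (· ≠ a)) hia,
      Multiset.count_filter_of_pos (p := (· ≠ a)) hia]
  rw [h1, h2, ← Multiset.count_add]
  by_cases ha : a ∈ (A + B).toFinset
  · rw [Finset.mul_prod_erase _ (fun i => qBinom q ((A + B).count i) (A.count i)) ha]
  · rw [Finset.erase_eq_of_notMem ha]
    rw [Multiset.mem_toFinset] at ha
    have hA : a ∉ A := fun h => ha (Multiset.mem_add.2 (Or.inl h))
    rw [Multiset.count_eq_zero_of_notMem ha, Multiset.count_eq_zero_of_notMem hA,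
      qBinom_zero_right, one_mul]

theorem invPairs_cons_left {a : ℕ} (A B : Multiset ℕ) (hB : ∀ y ∈ B, a ≤ y) :
    invPairs (a ::ₘ A) B = invPairs A B := by
  have h : (a ::ₘ A).product B = B.map (Prod.mk a) + A.product B := Multiset.cons_product _ _ _
  have h0 : (B.map (Prod.mk a)).filter (fun p => p.2 < p.1) = 0 := by
    rw [Multiset.filter_eq_nil]
    intro p hp
    obtain ⟨y, hy, rfl⟩ := Multiset.mem_map.1 hp
    exact (hB y hy).not_gt
  rw [invPairs, h, Multiset.filter_add, h0, zero_add, invPairs]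

theorem invPairs_cons_right {a : ℕ} (A B : Multiset ℕ) (hA : ∀ x ∈ A, a ≤ x) :
    invPairs A (a ::ₘ B) + A.count a = A.card + invPairs A B := by
  have h : A.product (a ::ₘ B) = A.map (fun x => (x, a)) + A.product B :=
    Multiset.product_cons _ _ _
  have h0 : ((A.map (fun x => (x, a))).filter (fun p => p.2 < p.1)).card + A.count a
      = A.card := by
    rw [Multiset.filter_map, Multiset.card_map, Multiset.count_eq_card_filter_eq,
      ← Multiset.card_add]
    conv_rhs => rw [← Multiset.filter_add_not (fun x => a < x) A]
    congr 2
    refine Multiset.filter_congr fun x hx => ?_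
    have := hA x hx
    omega
  rw [invPairs, h, Multiset.filter_add, Multiset.card_add, invPairs]
  omega

theorem sum_boolWord_succ {M : Type*} [AddCommMonoid M] {m : ℕ} (f : (Fin (m + 1) → Bool) → M) :
    ∑ b, f b = ∑ b, f (Fin.cons true b) + ∑ b, f (Fin.cons false b) := by
  rw [← (Fin.consEquiv fun _ => Bool).sum_comp, Fintype.sum_prod_type, Fintype.sum_bool]
  rfl

theorem sum_pow_wordInv_succ {m : ℕ} (ρ : Fin (m + 1) → ℕ) (C : Multiset ℕ) :
    ∑ b ∈ Finset.univ.filter (fun b => wordContent ρ b = C), q ^ wordInv b =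
      (if ρ 0 ∈ C then ∑ b ∈ Finset.univ.filter
        (fun b => wordContent (fun p => ρ p.succ) b = C.erase (ρ 0)), q ^ wordInv b else 0) +
      q ^ C.card * ∑ b ∈ Finset.univ.filter
        (fun b => wordContent (fun p => ρ p.succ) b = C), q ^ wordInv b := by
  rw [Finset.sum_filter, sum_boolWord_succ]
  simp only [wordContent_cons, wordInv_cons fun p => ρ p.succ, if_true,
    zero_add, Bool.false_eq_true, if_false]
  congr 1
  · split_ifs with h
    · rw [Finset.sum_filter]
      refine Finset.sum_congr rfl fun b _ => ?_
      obtain ⟨C', rfl⟩ := Multiset.exists_cons_of_mem h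
      simp only [Multiset.singleton_add, Multiset.erase_cons_head, Multiset.cons_inj_right]
    · refine Finset.sum_eq_zero fun b _ => if_neg ?_
      rintro rfl
      simp at h
  · rw [Finset.mul_sum, Finset.sum_filter]
    refine Finset.sum_congr rfl fun b _ => ?_
    split_ifs with h
    · rw [pow_add, h]
    · rfl

theorem wordContent_le {m : ℕ} (ρ : Fin m → ℕ) (b : Fin m → Bool) :
    wordContent ρ b ≤ ∑ p, {ρ p} := by
  refine Finset.sum_le_sum fun p _ => ?_
  split_ifs
  · exact le_rfl
  · exact Multiset.zero_le _

theorem sum_pow_wordInv {m : ℕ} (ρ : Fin m → ℕ) (hρ : Monotone ρ) (A B : Multiset ℕ)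
    (hAB : A + B = ∑ p, {ρ p}) :
    ∑ b ∈ Finset.univ.filter (fun b => wordContent ρ b = A), q ^ wordInv b =
      qBinomProd q A B * q ^ invPairs A B := by
  induction m generalizing A B with
  | zero =>
    rw [Finset.univ_eq_empty, Finset.sum_empty, add_eq_zero] at hAB
    obtain ⟨rfl, rfl⟩ := hAB
    rw [Finset.filter_true_of_mem fun b _ => by simp [wordContent]]
    have h0 : Multiset.product (0 : Multiset ℕ) (0 : Multiset ℕ) = 0 := rfl
    simp [qBinomProd, invPairs, wordInv, h0]
  | succ m ih =>
    rw [sum_pow_wordInv_succ]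
    have hρ' : Monotone fun p : Fin m => ρ p.succ := fun x y h => hρ (Fin.succ_le_succ_iff.2 h)
    have hmin : ∀ x ∈ A + B, ρ 0 ≤ x := by
      intro x hx
      rw [hAB, Multiset.mem_sum] at hx
      obtain ⟨p, -, hp⟩ := hx
      rw [Multiset.mem_singleton.1 hp]
      exact hρ (Fin.zero_le p)
    rw [Fin.sum_univ_succ, Multiset.singleton_add] at hAB
    generalize ρ 0 = a at *
    have hA : ∀ x ∈ A, a ≤ x := fun x hx => hmin x (Multiset.mem_add.2 (Or.inl hx))
    have hB : ∀ x ∈ B, a ≤ x := fun x hx => hmin x (Multiset.mem_add.2 (Or.inr hx))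
    have hfirst : ∀ A', A = a ::ₘ A' → (if a ∈ A then ∑ b ∈ Finset.univ.filter
        (fun b => wordContent (fun p => ρ p.succ) b = A.erase a), q ^ wordInv b else 0)
          = qBinomProd q A' B * q ^ invPairs A' B := by
      rintro A' rfl
      rw [if_pos (Multiset.mem_cons_self _ _), Multiset.erase_cons_head]
      refine ih _ hρ' _ _ ?_
      rwa [Multiset.cons_add, Multiset.cons_inj_right] at hAB
    have hsecond : ∀ B', B = a ::ₘ B' → ∑ b ∈ Finset.univ.filter
        (fun b => wordContent (fun p => ρ p.succ) b = A), q ^ wordInv b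
          = qBinomProd q A B' * q ^ invPairs A B' := by
      rintro B' rfl
      refine ih _ hρ' _ _ ?_
      rwa [Multiset.add_cons, Multiset.cons_inj_right] at hAB
    by_cases haB : a ∈ B
    · obtain ⟨B', rfl⟩ := Multiset.exists_cons_of_mem haB
      rw [hsecond B' rfl]
      have hinv := invPairs_cons_right A B' hA
      by_cases haA : a ∈ A
      · obtain ⟨A', rfl⟩ := Multiset.exists_cons_of_mem haA
        have hinv' : invPairs (a ::ₘ A') (a ::ₘ B') = invPairs A' (a ::ₘ B') :=
          invPairs_cons_left _ _ hB
        rw [hfirst A' rfl, ← hinv', qBinomProd_eq_mul_filter q a A' (a ::ₘ B'),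
          qBinomProd_eq_mul_filter q a (a ::ₘ A') B',
          qBinomProd_eq_mul_filter q a (a ::ₘ A') (a ::ₘ B')]
        simp only [Multiset.count_cons_self, Multiset.filter_cons_of_neg, ne_eq,
          not_true_eq_false, not_false_eq_true] at hinv ⊢
        rw [show A'.count a + 1 + (B'.count a + 1) = (A'.count a + B'.count a + 1) + 1 by ring,
          qBinom, show A'.count a + 1 + B'.count a = A'.count a + B'.count a + 1 by ring,
          ← add_assoc (A'.count a)]
        have hpow : q ^ (a ::ₘ A').card * q ^ invPairs (a ::ₘ A') B'
            = q ^ invPairs (a ::ₘ A') (a ::ₘ B') * q ^ (A'.count a + 1) := by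
          rw [← pow_add, ← pow_add, hinv]
        linear_combination (qBinom q (A'.count a + B'.count a + 1) (A'.count a + 1) *
          qBinomProd q (A'.filter fun x => ¬ x = a) (B'.filter fun x => ¬ x = a)) * hpow
      · rw [if_neg haA, zero_add, qBinomProd_eq_mul_filter q a A B',
          qBinomProd_eq_mul_filter q a A (a ::ₘ B')]
        rw [Multiset.count_eq_zero_of_notMem haA] at hinv ⊢
        rw [add_zero] at hinv
        rw [qBinom_zero_right, qBinom_zero_right, hinv, pow_add]
        simp only [Multiset.filter_cons_of_neg, ne_eq, not_true_eq_false, not_false_eq_true]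
        ring
    · have haA : a ∈ A := by
        have : a ∈ A + B := by rw [hAB]; exact Multiset.mem_cons_self _ _
        exact (Multiset.mem_add.1 this).resolve_right haB
      obtain ⟨A', rfl⟩ := Multiset.exists_cons_of_mem haA
      rw [hfirst A' rfl, Finset.filter_false_of_mem, Finset.sum_empty, mul_zero, add_zero,
        invPairs_cons_left _ _ hB, qBinomProd_eq_mul_filter q a A',
        qBinomProd_eq_mul_filter q a (a ::ₘ A'), Multiset.count_eq_zero_of_notMem haB, add_zero,
        add_zero, qBinom_self, qBinom_self]
      · simp only [Multiset.filter_cons_of_neg, ne_eq, not_true_eq_false, not_false_eq_true]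
      · intro b _ hb
        have hle := Multiset.count_le_of_le a (wordContent_le (fun p : Fin m => ρ p.succ) b)
        have hcount := congrArg (Multiset.count a) hAB
        rw [hb] at hle
        rw [Multiset.count_add, Multiset.count_cons_self, Multiset.count_cons_self,
          Multiset.count_eq_zero_of_notMem haB] at hcount
        rw [Multiset.count_cons_self] at hle
        omega

end GeneratingFunction

section TwoBlocks

variable {m : ℕ}

/-- The permutations of `Fin m` preserving the initial segment of length `r`. -/
def blockSubgroup (m r : ℕ) : Subgroup (Equiv.Perm (Fin m)) where
  carrier := {v | ∀ x, (v x : ℕ) < r ↔ (x : ℕ) < r}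
  one_mem' _ := Iff.rfl
  mul_mem' {a b} ha hb x := (ha (b x)).trans (hb x)
  inv_mem' {a} ha x := by
    simpa only [Equiv.Perm.coe_inv, Equiv.apply_symm_apply] using (ha (a⁻¹ x)).symm

theorem mem_blockSubgroup {r : ℕ} {v : Equiv.Perm (Fin m)} :
    v ∈ blockSubgroup m r ↔ ∀ x, (v x : ℕ) < r ↔ (x : ℕ) < r := Iff.rfl

/-- The permutations `g` such that the values less than `r` appear in increasing order in `g`,
and so do the values at least `r`. -/
def blockReps (m r : ℕ) : Finset (Equiv.Perm (Fin m)) :=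
  Finset.univ.filter fun g => ∀ x y : Fin m, x < y → ((x : ℕ) < r ↔ (y : ℕ) < r) → g⁻¹ x < g⁻¹ y

theorem mem_blockReps {r : ℕ} {g : Equiv.Perm (Fin m)} :
    g ∈ blockReps m r ↔
      ∀ x y : Fin m, x < y → ((x : ℕ) < r ↔ (y : ℕ) < r) → g⁻¹ x < g⁻¹ y := by
  simp [blockReps]

theorem eq_one_of_mul_mem_blockReps {r : ℕ} {u g : Equiv.Perm (Fin m)}
    (hu : u ∈ blockSubgroup m r) (hg : g ∈ blockReps m r) (hug : u * g ∈ blockReps m r) :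
    u = 1 := by
  have hu' := mem_blockSubgroup.1 (inv_mem hu)
  rw [mem_blockReps] at hg hug
  refine inv_eq_one.1 (eq_one_of_strictMono fun x y hxy => ?_)
  by_cases hb : (x : ℕ) < r ↔ (y : ℕ) < r
  · have h := hug x y hxy hb
    rw [mul_inv_rev, Equiv.Perm.mul_apply, Equiv.Perm.mul_apply] at h
    by_contra hle
    rcases (not_lt.1 hle).lt_or_eq with h' | h'
    · exact h.not_gt (hg _ _ h' (by rw [hu', hu', hb]))
    · rw [h'] at h
      exact lt_irrefl _ h
  · have hx := hu' x
    have hy := hu' y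
    rw [Fin.lt_def] at hxy ⊢
    omega

theorem factorization_unique {r : ℕ} {v v' g g' : Equiv.Perm (Fin m)}
    (hv : v ∈ blockSubgroup m r) (hv' : v' ∈ blockSubgroup m r)
    (hg : g ∈ blockReps m r) (hg' : g' ∈ blockReps m r) (h : v * g = v' * g') :
    v = v' ∧ g = g' := by
  have e : g' = (v'⁻¹ * v) * g := by rw [mul_assoc, h, inv_mul_cancel_left]
  have h1 := eq_one_of_mul_mem_blockReps (mul_mem (inv_mem hv') hv) hg (e ▸ hg')
  rw [h1, one_mul] at e
  exact ⟨(inv_mul_eq_one.1 h1).symm, e.symm⟩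

theorem exists_factorization (r : ℕ) (w : Equiv.Perm (Fin m)) :
    ∃ v ∈ blockSubgroup m r, ∃ g ∈ blockReps m r, v * g = w := by
  obtain ⟨u, hu, hmin⟩ := Finset.exists_min_image
    (Finset.univ.filter (· ∈ blockSubgroup m r)) (fun u => permLength (u * w))
    ⟨1, by simp [one_mem]⟩
  simp only [Finset.mem_filter, Finset.mem_univ, true_and] at hu hmin
  refine ⟨u⁻¹, inv_mem hu, u * w, mem_blockReps.2 fun x y hxy hb => ?_, by group⟩
  refine lt_of_adjacent_lt hxy fun i h hi hi' => ?_
  by_contra hasc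
  have hasc' := (not_isAscent_iff (u * w) h).1 hasc
  have hl := permLength_adjT_mul _ h hasc'
  rw [← mul_assoc (adjT i h) (adjT i h), adjT_mul_self, one_mul, ← mul_assoc] at hl
  have hadj : adjT i h ∈ blockSubgroup m r := by
    intro z
    rw [adjT_apply_val]
    split_ifs <;> omega
  have := hmin _ (mul_mem hadj hu)
  omega

theorem sum_blockReps_mul {M : Type*} [AddCommMonoid M] (r : ℕ)
    (P : Equiv.Perm (Fin m) → Prop) [DecidablePred P]
    (hP : ∀ v ∈ blockSubgroup m r, ∀ g, P (v * g) ↔ P g)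
    (f : Equiv.Perm (Fin m) → M) :
    ∑ w ∈ Finset.univ.filter P, f w =
      ∑ g ∈ (blockReps m r).filter P,
        ∑ v ∈ Finset.univ.filter (· ∈ blockSubgroup m r), f (v * g) := by
  rw [← Finset.sum_product']
  symm
  refine Finset.sum_bij (fun x _ => x.2 * x.1) ?_ ?_ ?_ fun _ _ => rfl
  · rintro ⟨g, v⟩ h
    simp only [Finset.mem_product, Finset.mem_filter, Finset.mem_univ, true_and] at h ⊢
    exact (hP v h.2 g).2 h.1.2
  · rintro ⟨g, v⟩ h ⟨g', v'⟩ h' e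
    simp only [Finset.mem_product, Finset.mem_filter, Finset.mem_univ, true_and] at h h'
    obtain ⟨h1, h2⟩ := factorization_unique h.2 h'.2 h.1.1 h'.1.1 e
    rw [h1, h2]
  · intro w hw
    obtain ⟨v, hv, g, hg, rfl⟩ := exists_factorization r w
    simp only [Finset.mem_filter, Finset.mem_univ, true_and] at hw
    exact ⟨(g, v), by simp [hg, hv, (hP v hv g).1 hw], rfl⟩

/-- The word recording at which positions `w` takes values less than `r`. -/
def valueWord (r : ℕ) (w : Equiv.Perm (Fin m)) : Fin m → Bool := fun p => decide ((w p : ℕ) < r)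

theorem valueWord_mul {r : ℕ} {v : Equiv.Perm (Fin m)} (hv : v ∈ blockSubgroup m r)
    (g : Equiv.Perm (Fin m)) : valueWord r (v * g) = valueWord r g :=
  funext fun p => decide_eq_decide.2 (hv (g p))

theorem permLength_eq_wordInv {r : ℕ} {g : Equiv.Perm (Fin m)} (hg : g ∈ blockReps m r) :
    permLength g = wordInv (valueWord r g) := by
  rw [permLength, Finset.card_filter, Fintype.sum_prod_type, wordInv]
  refine Finset.sum_congr rfl fun p _ => Finset.sum_congr rfl fun p' _ => ?_
  congr 1
  simp only [valueWord, decide_eq_false_iff_not, decide_eq_true_eq, eq_iff_iff]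
  refine and_congr_right fun hp => ?_
  constructor
  · intro h
    have h2 := mt (mem_blockReps.1 hg _ _ h)
    simp only [Equiv.Perm.coe_inv, Equiv.symm_apply_apply] at h2
    have h3 := h2 hp.not_gt
    rw [Fin.lt_def] at h
    omega
  · intro h
    rw [Fin.lt_def]
    omega

theorem exists_valueWord_eq {r : ℕ} (hr : r ≤ m) (b : Fin m → Bool)
    (hb : ∑ p, (if b p = true then 1 else 0) = r) :
    ∃ w : Equiv.Perm (Fin m), valueWord r w = b := by
  obtain ⟨w, hw⟩ := exists_perm_of_wordContent_eq (fun _ => 0) b (valueWord r 1) (by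
    have h : ∀ c : Fin m → Bool, wordContent (fun _ => 0) c =
        Multiset.replicate (∑ p, if c p = true then 1 else 0) 0 := fun c => by
      rw [← card_wordContent fun _ => 0]
      refine Multiset.eq_replicate_card.2 fun x hx => ?_
      obtain ⟨p, -, hp⟩ := Multiset.mem_sum.1 hx
      split_ifs at hp
      · exact Multiset.mem_singleton.1 hp
      · exact absurd hp (Multiset.notMem_zero _)
    rw [h, h, hb]
    congr 1
    obtain ⟨k, rfl⟩ := Nat.exists_eq_add_of_le hr
    simp [valueWord, Fin.sum_univ_add])
  exact ⟨w, funext fun p => (hw p).2⟩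

theorem sum_pow_permLength {F : Type*} [Field F] (q : F) {r : ℕ} (hr : r ≤ m) (ρ : Fin m → ℕ)
    (C : Multiset ℕ) (hC : C.card = r) :
    ∑ g ∈ (blockReps m r).filter (fun g => wordContent ρ (valueWord r g) = C),
        q ^ permLength g =
      ∑ b ∈ Finset.univ.filter (fun b => wordContent ρ b = C), q ^ wordInv b := by
  refine Finset.sum_bij (fun g _ => valueWord r g) ?_ ?_ ?_ ?_
  · intro g hg
    simpa using (Finset.mem_filter.1 hg).2
  · intro g hg g' hg' h
    have hu : g' * g⁻¹ ∈ blockSubgroup m r := fun x => by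
      have := congrFun h (g⁻¹ x)
      simp only [valueWord, decide_eq_decide, Equiv.Perm.coe_inv, Equiv.apply_symm_apply] at this
      exact this.symm
    have := eq_one_of_mul_mem_blockReps hu (Finset.mem_filter.1 hg).1
      (by rw [inv_mul_cancel_right]; exact (Finset.mem_filter.1 hg').1)
    exact (mul_inv_eq_one.1 this).symm
  · intro b hb
    simp only [Finset.mem_filter, Finset.mem_univ, true_and] at hb
    obtain ⟨w, hw⟩ := exists_valueWord_eq hr b (by rw [← card_wordContent ρ, hb, hC])
    obtain ⟨v, hv, g, hg, rfl⟩ := exists_factorization r w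
    rw [valueWord_mul hv] at hw
    exact ⟨g, Finset.mem_filter.2 ⟨hg, by rw [hw, hb]⟩, hw⟩
  · intro g hg
    rw [permLength_eq_wordInv (Finset.mem_filter.1 hg).1]

end TwoBlocks

namespace IsHeckeBasis

variable {F : Type*} [Field F] {H : Type*} [Ring H] [Algebra F H] {m : ℕ} {q : F}
  {T : Equiv.Perm (Fin m) → H}

theorem mul_blockReps (hT : IsHeckeBasis q T) {r : ℕ} {v g : Equiv.Perm (Fin m)}
    (hv : v ∈ blockSubgroup m r) (hg : g ∈ blockReps m r) : T g * T v = T (v * g) := by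
  refine hT.mul_of_inversions g v fun x y hxy hvxy => mem_blockReps.1 hg x y hxy ?_
  have hx := hv x
  have hy := hv y
  rw [Fin.lt_def] at hxy hvxy
  omega

theorem mul_blockReps_inv (hT : IsHeckeBasis q T) {r : ℕ} {v g : Equiv.Perm (Fin m)}
    (hv : v ∈ blockSubgroup m r) (hg : g ∈ blockReps m r) : T v * T g⁻¹ = T (g⁻¹ * v) := by
  refine hT.mul_of_inversions v g⁻¹ fun x y hxy hgxy => ?_
  have h := mt (mem_blockReps.1 hg x y hxy) hgxy.not_gt
  have hx := mem_blockSubgroup.1 (inv_mem hv) x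
  have hy := mem_blockSubgroup.1 (inv_mem hv) y
  rw [Fin.lt_def] at hxy ⊢
  omega

theorem sum_mul_sum_inv (hT : IsHeckeBasis q T) (r : ℕ) :
    (∑ v ∈ Finset.univ.filter (· ∈ blockSubgroup m r), T v) * ∑ g ∈ blockReps m r, T g⁻¹
      = ∑ w, T w := by
  have h := sum_blockReps_mul r (fun _ => True) (fun _ _ _ => Iff.rfl) fun w => T w⁻¹
  rw [Finset.filter_true, Finset.filter_true, Finset.sum_comm] at h
  rw [← Equiv.sum_comp (Equiv.inv (Equiv.Perm (Fin m))) T]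
  simp only [Equiv.inv_apply]
  rw [h, Finset.sum_mul_sum, Finset.sum_bij' (fun v _ => v⁻¹) (fun v _ => v⁻¹)]
  · simp
  · simp
  · simp
  · simp
  · intro v hv
    refine Finset.sum_congr rfl fun g hg => ?_
    rw [hT.mul_blockReps_inv (Finset.mem_filter.1 hv).2 hg, mul_inv_rev, inv_inv]

theorem sum_filter_mul (hT : IsHeckeBasis q T) {r : ℕ} (hr : r ≤ m) (ρ : Fin m → ℕ)
    (hρ : Monotone ρ) (A B : Multiset ℕ) (hA : A.card = r) (hAB : A + B = ∑ p, {ρ p}) :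
    (∑ w ∈ Finset.univ.filter (fun w => wordContent ρ (valueWord r w) = A), T w) *
        ∑ g ∈ blockReps m r, T g⁻¹
      = (qBinomProd q A B * q ^ invPairs A B) • ∑ w, T w := by
  rw [sum_blockReps_mul r (fun w => wordContent ρ (valueWord r w) = A)
    fun v hv g => by rw [valueWord_mul hv]]
  have h : ∀ g ∈ (blockReps m r).filter (fun w => wordContent ρ (valueWord r w) = A),
      ∑ v ∈ Finset.univ.filter (· ∈ blockSubgroup m r), T (v * g) =
        T g * ∑ v ∈ Finset.univ.filter (· ∈ blockSubgroup m r), T v := fun g hg => by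
    rw [Finset.mul_sum]
    refine Finset.sum_congr rfl fun v hv => ?_
    rw [hT.mul_blockReps (Finset.mem_filter.1 hv).2 (Finset.mem_filter.1 hg).1]
  rw [Finset.sum_congr rfl h, ← Finset.sum_mul, mul_assoc, hT.sum_mul_sum_inv, Finset.sum_mul,
    Finset.sum_congr rfl fun g _ => hT.mul_sum g, ← Finset.sum_smul,
    sum_pow_permLength q hr ρ A hA, sum_pow_wordInv q ρ hρ A B hAB]

end IsHeckeBasis

section Rows

theorem rowOf_le_rowOf {lam : ℕ → ℕ} {m p p' : ℕ} (hlam : ∃ N, m ≤ cumSum lam N) (h : p ≤ p')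
    (hp' : p' < m) : rowOf lam p ≤ rowOf lam p' := by
  obtain ⟨N, hN⟩ := hlam
  have hmem : rowOf lam p' ∈ {r | p' < cumSum lam (r + 1)} := by
    refine Nat.sInf_mem ⟨N, hp'.trans_le (hN.trans ?_)⟩
    rw [cumSum, cumSum, Finset.sum_range_succ]
    exact Nat.le_add_right _ _
  exact Nat.sInf_le (h.trans_lt hmem)

theorem exists_card_le_cumSum_count (A : Multiset ℕ) :
    ∃ N, A.card ≤ cumSum (fun v => A.count v) N := by
  refine ⟨A.sup + 1, ?_⟩
  rw [cumSum, ← Multiset.toFinset_sum_count_eq]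
  refine Finset.sum_le_sum_of_subset fun a ha => ?_
  rw [Finset.mem_range, Nat.lt_succ_iff]
  exact Multiset.le_sup (Multiset.mem_toFinset.1 ha)

theorem rowOf_comp1 {m p : ℕ} (h : p < m) : rowOf (comp1 m) p = 0 :=
  Nat.sInf_eq_zero.2 (Or.inl (by simpa [cumSum, comp1] using h))

theorem rowOf_comp2_of_lt {r k p : ℕ} (h : p < r) : rowOf (comp2 r k) p = 0 :=
  Nat.sInf_eq_zero.2 (Or.inl (by simpa [cumSum, comp2] using h))

theorem rowOf_comp2_of_le {r k p : ℕ} (h : r ≤ p) (h' : p < r + k) :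
    rowOf (comp2 r k) p = 1 := by
  have h1 : rowOf (comp2 r k) p ≤ 1 :=
    Nat.sInf_le (by simpa [cumSum, comp2, Finset.sum_range_succ] using h')
  have h2 : rowOf (comp2 r k) p ∈ {s | p < cumSum (comp2 r k) (s + 1)} :=
    Nat.sInf_mem ⟨1, by simpa [cumSum, comp2, Finset.sum_range_succ] using h'⟩
  have h3 : rowOf (comp2 r k) p ≠ 0 := fun h0 => by
    rw [h0] at h2
    simp only [Set.mem_ofPred_eq, cumSum, zero_add, Finset.sum_range_one, comp2, if_true] at h2
    omega
  omega

theorem sum_range_getD (L : List ℕ) :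
    ∑ x ∈ Finset.range L.length, ({L.getD x 0} : Multiset ℕ) = L := by
  induction L with
  | nil => rfl
  | cons a L ih =>
    rw [List.length_cons, Finset.sum_range_succ']
    simp only [List.getD_cons_succ, List.getD_cons_zero, ih]
    rw [add_comm, Multiset.singleton_add, Multiset.cons_coe]

theorem sum_range_getD_sort (A : Multiset ℕ) {r : ℕ} (hA : A.card = r) :
    ∑ x ∈ Finset.range r, ({(A.sort (· ≤ ·)).getD x 0} : Multiset ℕ) = A := by
  have h := sum_range_getD (A.sort (· ≤ ·))
  rwa [Multiset.length_sort, hA, Multiset.sort_eq] at h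

variable {m : ℕ}

theorem mem_youngW_comp1 (w : Equiv.Perm (Fin m)) : w ∈ youngW (comp1 m) := fun p => by
  rw [rowOf_comp1 p.2, rowOf_comp1 (w p).2]

theorem XPhi_comp1 {H : Type*} [Ring H] (T : Equiv.Perm (Fin m) → H) (lam : ℕ → ℕ)
    (d : Equiv.Perm (Fin m)) : XPhi T lam (comp1 m) d = ∑ w, T w := by
  rw [XPhi, Finset.filter_true_of_mem fun w _ =>
    ⟨1, fun _ => rfl, w * d⁻¹, mem_youngW_comp1 _, by group⟩]

theorem mem_youngW_comp2 {r : ℕ} (hr : r ≤ m) (w : Equiv.Perm (Fin m)) :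
    w ∈ youngW (comp2 r (m - r)) ↔ w ∈ blockSubgroup m r := by
  have h : ∀ p : Fin m, rowOf (comp2 r (m - r)) p = if (p : ℕ) < r then 0 else 1 := fun p => by
    split_ifs with hp
    · exact rowOf_comp2_of_lt hp
    · exact rowOf_comp2_of_le (not_lt.1 hp) (by omega)
  rw [mem_blockSubgroup]
  refine forall_congr' fun p => ?_
  rw [h, h]
  split_ifs with h1 h2 h2 <;> simp [h1, h2]

theorem mem_doubleCoset_comp2 {r : ℕ} (hr : r ≤ m) (lam : ℕ → ℕ) (d w : Equiv.Perm (Fin m)) :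
    w ∈ doubleCoset lam (comp2 r (m - r)) d ↔
      wordContent (fun p : Fin m => rowOf lam p) (valueWord r w)
        = wordContent (fun p : Fin m => rowOf lam p) (valueWord r d) := by
  constructor
  · rintro ⟨u, hu, v, hv, rfl⟩
    rw [mul_assoc, valueWord_mul ((mem_youngW_comp2 hr v).1 hv), wordContent, wordContent,
      ← Equiv.sum_comp u fun p => if valueWord r d p then ({rowOf lam p} : Multiset ℕ) else 0]
    refine Finset.sum_congr rfl fun p _ => ?_
    rw [hu p]
    rfl
  · intro h
    obtain ⟨u, hu⟩ := exists_perm_of_wordContent_eq _ _ _ h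
    refine ⟨u, fun p => (hu p).1, w * u⁻¹ * d⁻¹, (mem_youngW_comp2 hr _).2 fun x => ?_, by group⟩
    have := (hu (u⁻¹ (d⁻¹ x))).2
    simp only [valueWord, decide_eq_decide, Equiv.Perm.coe_inv, Equiv.apply_symm_apply] at this
    exact this.symm

theorem wordContent_of_is1A {r : ℕ} (hr : r ≤ m) {A B : Multiset ℕ} (hA : A.card = r)
    (hB : B.card = m - r) {lam : ℕ → ℕ} {d : Equiv.Perm (Fin m)}
    (hd : Is1A (comp2 r (m - r)) lam (rows2 A B) d) :
    wordContent (fun p : Fin m => rowOf lam p) (valueWord r d) = A ∧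
      A + B = ∑ p : Fin m, {rowOf lam p} := by
  obtain ⟨k, rfl⟩ := Nat.exists_eq_add_of_le hr
  rw [Nat.add_sub_cancel_left] at hB hd
  have hlt : ∀ x < r, entryAt (rows2 A B) (rowOf (comp2 r k) x)
      (x - cumSum (comp2 r k) (rowOf (comp2 r k) x)) = (A.sort (· ≤ ·)).getD x 0 := by
    intro x hx
    rw [rowOf_comp2_of_lt hx]
    rfl
  have hge : ∀ x < k, entryAt (rows2 A B) (rowOf (comp2 r k) (r + x))
      (r + x - cumSum (comp2 r k) (rowOf (comp2 r k) (r + x))) = (B.sort (· ≤ ·)).getD x 0 := by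
    intro x hx
    rw [rowOf_comp2_of_le (Nat.le_add_right r x) (Nat.add_lt_add_left hx r)]
    simp [cumSum, comp2, entryAt, rows2]
  constructor
  · rw [← sum_range_getD_sort A hA, wordContent]
    simp only [← hd.2, valueWord]
    rw [Equiv.sum_comp d fun x => if decide ((x : ℕ) < r) = true then
      ({entryAt (rows2 A B) (rowOf (comp2 r k) x)
        (x - cumSum (comp2 r k) (rowOf (comp2 r k) x))} : Multiset ℕ) else 0,
      Fin.sum_univ_add, Finset.sum_range]
    simp [hlt]
  · simp only [← hd.2]
    rw [Equiv.sum_comp d fun x => ({entryAt (rows2 A B) (rowOf (comp2 r k) x)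
        (x - cumSum (comp2 r k) (rowOf (comp2 r k) x))} : Multiset ℕ),
      Fin.sum_univ_add]
    conv_lhs => rw [← sum_range_getD_sort A hA, ← sum_range_getD_sort B hB]
    rw [Finset.sum_range, Finset.sum_range]
    simp [hlt, hge]

end Rows

/-- Proposition: merging the two rows of a two-row tableau.
`ξ = (r, m-r) ⊨ m`; `C` a row-standard `ξ`-tableau of type `α` (rows `C0`, `C1`,
so `α_v = C0_v + C1_v`); `B` the unique row-standard `(m)`-tableau of type `ξ`
(one row: `r` entries `0` and `m-r` entries `1`); `A` the unique row-standard
`(m)`-tableau of type `α` (one row `C0 ⊔ C1`).  Then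
`φ_B φ_C = (∏_i [A^1_i, C^1_i]) (∏_{i<j} q^{C^1_j C^2_i}) φ_A`
as homomorphisms `M^{(m)} → M^α` (apply `φ_B` first). -/
theorem merge_two_rows
    {F : Type*} [Field F] {H : Type*} [Ring H] [Algebra F H]
    {m r : ℕ} (hrm : r ≤ m)
    (q : F) (hq : q ≠ 0)
    (T : Equiv.Perm (Fin m) → H) (hT : IsHeckeBasis q T)
    (C0 C1 : Multiset ℕ) (hC0 : C0.card = r) (hC1 : C1.card = m - r)
    (dB : Equiv.Perm (Fin m))
    (hdB : Is1A (comp1 m) (comp2 r (m - r))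
      (rows1 (Multiset.replicate r 0 + Multiset.replicate (m - r) 1)) dB)
    (dC : Equiv.Perm (Fin m))
    (hdC : Is1A (comp2 r (m - r)) (fun v => (C0 + C1).count v) (rows2 C0 C1) dC)
    (dA : Equiv.Perm (Fin m))
    (hdA : Is1A (comp1 m) (fun v => (C0 + C1).count v) (rows1 (C0 + C1)) dA)
    (Mm : Submodule Hᵐᵒᵖ H) (hMm : Mm = Submodule.span Hᵐᵒᵖ {xElt T (comp1 m)})
    (Mxi : Submodule Hᵐᵒᵖ H) (hMxi : Mxi = Submodule.span Hᵐᵒᵖ {xElt T (comp2 r (m - r))})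
    (hxm : xElt T (comp1 m) ∈ Mm) (hxxi : xElt T (comp2 r (m - r)) ∈ Mxi)
    (φB : Mm →ₗ[Hᵐᵒᵖ] H)
    (hφB : φB ⟨xElt T (comp1 m), hxm⟩ = XPhi T (comp2 r (m - r)) (comp1 m) dB)
    (hrange : ∀ z : Mm, φB z ∈ Mxi)
    (φC : Mxi →ₗ[Hᵐᵒᵖ] H)
    (hφC : φC ⟨xElt T (comp2 r (m - r)), hxxi⟩
      = XPhi T (fun v => (C0 + C1).count v) (comp2 r (m - r)) dC)
    (φA : Mm →ₗ[Hᵐᵒᵖ] H)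
    (hφA : φA ⟨xElt T (comp1 m), hxm⟩ = XPhi T (fun v => (C0 + C1).count v) (comp1 m) dA) :
    ∀ z : Mm, φC ⟨φB z, hrange z⟩
      = (qBinomProd q C0 C1 * q ^ invPairs C0 C1) • φA z := by
  have hρ : Monotone fun p : Fin m => rowOf (fun v => (C0 + C1).count v) p := fun p p' h =>
    rowOf_le_rowOf (m := m) (by
      obtain ⟨N, hN⟩ := exists_card_le_cumSum_count (C0 + C1)
      rw [Multiset.card_add, hC0, hC1] at hN
      exact ⟨N, by omega⟩) h p'.2
  obtain ⟨hcontent, hsum⟩ := wordContent_of_is1A hrm hC0 hC1 hdC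
  have hXC : XPhi T (fun v => (C0 + C1).count v) (comp2 r (m - r)) dC =
      ∑ w ∈ Finset.univ.filter (fun w => wordContent
        (fun p : Fin m => rowOf (fun v => (C0 + C1).count v) p) (valueWord r w) = C0), T w := by
    refine Finset.sum_congr (Finset.ext fun w => ?_) fun _ _ => rfl
    simp only [Finset.mem_filter, mem_doubleCoset_comp2 hrm, hcontent]
  have hxi : xElt T (comp2 r (m - r)) =
      ∑ v ∈ Finset.univ.filter (· ∈ blockSubgroup m r), T v := by
    refine Finset.sum_congr (Finset.ext fun w => ?_) fun _ _ => rfl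
    simp only [Finset.mem_filter, mem_youngW_comp2 hrm]
  have hBx : (⟨φB ⟨xElt T (comp1 m), hxm⟩, hrange _⟩ : Mxi) =
      MulOpposite.op (∑ g ∈ blockReps m r, T g⁻¹) • ⟨xElt T (comp2 r (m - r)), hxxi⟩ := by
    refine Subtype.ext ?_
    rw [Submodule.coe_smul, op_smul_eq_mul]
    change φB ⟨xElt T (comp1 m), hxm⟩ = xElt T (comp2 r (m - r)) * _
    rw [hφB, XPhi_comp1, hxi, hT.sum_mul_sum_inv]
  have hgen : φC ⟨φB ⟨xElt T (comp1 m), hxm⟩, hrange _⟩ =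
      (qBinomProd q C0 C1 * q ^ invPairs C0 C1) • φA ⟨xElt T (comp1 m), hxm⟩ := by
    rw [hBx, map_smul, hφC, hφA, XPhi_comp1, op_smul_eq_mul, hXC,
      hT.sum_filter_mul hrm _ hρ C0 C1 hC0 hsum]
  rintro ⟨z, hz⟩
  obtain ⟨a, rfl⟩ := Submodule.mem_span_singleton.1 (hMm ▸ hz)
  have hza : (⟨a • xElt T (comp1 m), hz⟩ : Mm) = a • ⟨xElt T (comp1 m), hxm⟩ := rfl
  have hBa : (⟨φB (a • ⟨xElt T (comp1 m), hxm⟩), hrange _⟩ : Mxi) =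
      a • ⟨φB ⟨xElt T (comp1 m), hxm⟩, hrange _⟩ := Subtype.ext (map_smul φB _ _)
  rw [hza, hBa, map_smul, map_smul, hgen, smul_comm]

end FayersSemistd
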